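/- Let b(x,y) be a complex polynomial in two variables and let B be the multiplication operator u ↦ b·u on the tempered distributions 𝒮′(ℝ²). Then B is regular in the sense of Shubin (i.e., b·u ∈ 𝒮(ℝ²) implies u ∈ 𝒮(ℝ²) for every u ∈ 𝒮′(ℝ²)) if and only if b(x,y) ≠ 0 for every (x,y) ∈ ℝ². -/

import Mathlib

/-!
STATEMENT 17. Let `b(x,y)` be a complex polynomial in two variables and `B : u ↦ b·u` the
multiplication operator on tempered distributions `𝒮'(ℝ²)`.  Then `B` is regular in the sense
of Shubin (i.e. `b·u ∈ 𝒮(ℝ²)` implies `u ∈ 𝒮(ℝ²)` for all `u ∈ 𝒮'(ℝ²)`) if and only if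
`b(x,y) ≠ 0` for all `(x,y) ∈ ℝ²`.

Tempered distributions are modeled as continuous linear functionals on `𝓢(ℝ², ℂ)`; the
multiplication operator on `𝒮'` is characterized by duality: `⟨Bu, φ⟩ = ⟨u, bφ⟩`.
-/

noncomputable section
open MeasureTheory Complex SchwartzMap

abbrev Fn2 := ℝ × ℝ → ℂ

/-- Evaluation of the complex polynomial `b` at a point of ℝ². -/
def bval (b : MvPolynomial (Fin 2) ℂ) (p : ℝ × ℝ) : ℂ :=
  MvPolynomial.eval ![(p.1 : ℂ), (p.2 : ℂ)] b

/-- The space of tempered distributions on ℝ². -/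
abbrev TD2 := 𝓢(ℝ × ℝ, ℂ) →L[ℂ] ℂ

def RepBy (u : TD2) (g : Fn2) : Prop :=
  ∀ φ : 𝓢(ℝ × ℝ, ℂ), u φ = ∫ p : ℝ × ℝ, g p * φ p

def InSchwartz (u : TD2) : Prop := ∃ g : 𝓢(ℝ × ℝ, ℂ), RepBy u ⇑g

/-- Regularity in the sense of Shubin. -/
def RegularTD (A : TD2 → TD2) : Prop := ∀ u : TD2, InSchwartz (A u) → InSchwartz u

/-- `f` is bounded below on `S` by a negative power of `1 + x ^ 2 + y ^ 2`. -/
def HasPolyLowerBound (f : ℝ × ℝ → ℝ) (S : Set (ℝ × ℝ)) : Prop :=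
  ∃ N : ℕ, ∃ c > 0, ∀ p ∈ S, c ≤ f p * (1 + p.1 ^ 2 + p.2 ^ 2) ^ N

lemma one_le_one_add_sq_add_sq (p : ℝ × ℝ) : 1 ≤ 1 + p.1 ^ 2 + p.2 ^ 2 := by
  nlinarith [sq_nonneg p.1, sq_nonneg p.2]

namespace HasPolyLowerBound

variable {f g : ℝ × ℝ → ℝ} {S T : Set (ℝ × ℝ)}

lemma mono (hf : HasPolyLowerBound f T) (h : S ⊆ T) : HasPolyLowerBound f S := by
  obtain ⟨N, c, hc, hN⟩ := hf
  exact ⟨N, c, hc, fun p hp ↦ hN p (h hp)⟩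

lemma mul (hf : HasPolyLowerBound f S) (hg : HasPolyLowerBound g S) :
    HasPolyLowerBound (fun p ↦ f p * g p) S := by
  obtain ⟨N, c, hc, hN⟩ := hf
  obtain ⟨M, d, hd, hM⟩ := hg
  refine ⟨N + M, c * d, by positivity, fun p hp ↦ ?_⟩
  calc c * d ≤ (f p * (1 + p.1 ^ 2 + p.2 ^ 2) ^ N) * (g p * (1 + p.1 ^ 2 + p.2 ^ 2) ^ M) :=
        mul_le_mul (hN p hp) (hM p hp) hd.le (hc.le.trans (hN p hp))
    _ = _ := by ring

lemma union (hS : HasPolyLowerBound f S) (hT : HasPolyLowerBound f T) :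
    HasPolyLowerBound f (S ∪ T) := by
  obtain ⟨N, c, hc, hN⟩ := hS
  obtain ⟨M, d, hd, hM⟩ := hT
  have key {p : ℝ × ℝ} {K L : ℕ} {e : ℝ} (he : 0 < e) (hKL : K ≤ L)
      (h : e ≤ f p * (1 + p.1 ^ 2 + p.2 ^ 2) ^ K) :
      e ≤ f p * (1 + p.1 ^ 2 + p.2 ^ 2) ^ L := by
    have hw := one_le_one_add_sq_add_sq p
    have hf : 0 ≤ f p := (pos_of_mul_pos_left (he.trans_le h) (by positivity)).le
    exact h.trans (mul_le_mul_of_nonneg_left (pow_le_pow_right₀ hw hKL) hf)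
  refine ⟨max N M, min c d, lt_min hc hd, fun p hp ↦ ?_⟩
  rcases hp with hp | hp
  · exact (min_le_left _ _).trans (key hc (le_max_left _ _) (hN p hp))
  · exact (min_le_right _ _).trans (key hd (le_max_right _ _) (hM p hp))

lemma of_isCompact (hS : IsCompact S) (hf : ContinuousOn f S) (hpos : ∀ p ∈ S, 0 < f p) :
    HasPolyLowerBound f S := by
  rcases S.eq_empty_or_nonempty with rfl | hne
  · exact ⟨0, 1, one_pos, by simp⟩
  · obtain ⟨q, hq, hmin⟩ := hS.exists_isMinOn hne hf
    exact ⟨0, f q, hpos q hq, fun p hp ↦ by simpa using hmin hp⟩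

end HasPolyLowerBound

lemma Polynomial.exists_eventually_le_abs_eval {R : Polynomial ℝ} (hR : R ≠ 0) :
    ∃ c > 0, ∀ᶠ x in Filter.atTop, c ≤ |R.eval x| := by
  rcases lt_or_ge 0 R.degree with h | h
  · exact ⟨1, one_pos, (R.abs_tendsto_atTop h).eventually_ge_atTop 1⟩
  · rw [Polynomial.eq_C_of_degree_le_zero h] at hR ⊢
    exact ⟨|R.coeff 0|, by simpa using hR, by simp⟩

open Polynomial in
lemma Polynomial.exists_abs_evalEval_le (A : ℝ[X][X]) :
    ∃ N : ℕ, ∃ K > 0, ∀ x y : ℝ, |A.evalEval x y| ≤ K * (1 + x ^ 2 + y ^ 2) ^ N := by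
  have hw (x y : ℝ) : 1 ≤ 1 + x ^ 2 + y ^ 2 := one_le_one_add_sq_add_sq (x, y)
  have add_bound {A B : ℝ[X][X]}
      (hA : ∃ N : ℕ, ∃ K > 0, ∀ x y : ℝ, |A.evalEval x y| ≤ K * (1 + x ^ 2 + y ^ 2) ^ N)
      (hB : ∃ N : ℕ, ∃ K > 0, ∀ x y : ℝ, |B.evalEval x y| ≤ K * (1 + x ^ 2 + y ^ 2) ^ N) :
      ∃ N : ℕ, ∃ K > 0, ∀ x y : ℝ, |(A + B).evalEval x y| ≤ K * (1 + x ^ 2 + y ^ 2) ^ N := by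
    obtain ⟨N, K, hK, hN⟩ := hA
    obtain ⟨M, L, hL, hM⟩ := hB
    refine ⟨max N M, K + L, by positivity, fun x y ↦ ?_⟩
    rw [evalEval_add, add_mul]
    refine (abs_add_le _ _).trans (add_le_add ((hN x y).trans ?_) ((hM x y).trans ?_))
    · exact mul_le_mul_of_nonneg_left (pow_le_pow_right₀ (hw x y) (le_max_left _ _)) hK.le
    · exact mul_le_mul_of_nonneg_left (pow_le_pow_right₀ (hw x y) (le_max_right _ _)) hL.le
  induction A using Polynomial.induction_on' with
  | add A B hA hB => exact add_bound hA hB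
  | monomial n a =>
    induction a using Polynomial.induction_on' with
    | add a b ha hb => rw [map_add]; exact add_bound ha hb
    | monomial m r =>
      refine ⟨m + n, |r| + 1, by positivity, fun x y ↦ ?_⟩
      have hx : |x| ≤ 1 + x ^ 2 + y ^ 2 := by
        nlinarith [sq_abs x, sq_nonneg (|x| - 1), sq_nonneg y]
      have hy : |y| ≤ 1 + x ^ 2 + y ^ 2 := by
        nlinarith [sq_abs y, sq_nonneg (|y| - 1), sq_nonneg x]
      simp only [evalEval, eval_monomial, eval_mul, eval_pow, eval_C, abs_mul, abs_pow, pow_add,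
        mul_assoc]
      gcongr
      linarith

open Polynomial in
/-- If `P` and its derivative in the second variable generate a nonzero polynomial `R` in the first
variable, then `P` satisfies a polynomial lower bound far out in the sector `|y| ≤ x`: on each
vertical segment `|P|` is minimal either at an end point or at a zero of the derivative, where
`R` is a multiple of `P`. -/
lemma hasPolyLowerBound_sector_of_combination {P A B : ℝ[X][X]} {R : ℝ[X]} (hR : R ≠ 0)
    (h : C R = A * P + B * derivative P) (hP : ∀ x y, P.evalEval x y ≠ 0) :
    ∃ r : ℝ, HasPolyLowerBound (fun p ↦ |P.evalEval p.1 p.2|) {p | r ≤ p.1 ∧ |p.2| ≤ p.1} := by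
  obtain ⟨N, K, hK, hA⟩ := A.exists_abs_evalEval_le
  have eval_diag (Q : ℝ[X]) (x : ℝ) : (P.eval Q).eval x = P.evalEval x (Q.eval x) := by
    rw [evalEval, ← coe_evalRingHom, ← eval₂_at_apply, ← eval₂_at_apply]
    simp
  have hne (Q : ℝ[X]) : P.eval Q ≠ 0 := fun h0 ↦
    hP 0 (Q.eval 0) (by rw [← eval_diag, h0, eval_zero])
  obtain ⟨c, hc, hcR⟩ := exists_eventually_le_abs_eval hR
  obtain ⟨c₁, hc₁, hcR₁⟩ := exists_eventually_le_abs_eval (hne X)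
  obtain ⟨c₂, hc₂, hcR₂⟩ := exists_eventually_le_abs_eval (hne (-X))
  obtain ⟨r, hr⟩ := Filter.eventually_atTop.1 (hcR.and (hcR₁.and hcR₂))
  refine ⟨r, N, min (min c₁ c₂) (c / (K * 2 ^ N)), by positivity, ?_⟩
  rintro ⟨x, y⟩ ⟨hrx : r ≤ x, hyx : |y| ≤ x⟩
  obtain ⟨hRx, h1x, h2x⟩ := hr x hrx
  rw [eval_diag, eval_X] at h1x
  rw [eval_diag, eval_neg, eval_X] at h2x
  dsimp only
  have hx : 0 ≤ x := (abs_nonneg y).trans hyx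
  have hw : 1 ≤ 1 + x ^ 2 + y ^ 2 := one_le_one_add_sq_add_sq (x, y)
  have eval_line (Q : ℝ[X][X]) (t : ℝ) :
      (Q.map (evalRingHom x)).eval t = Q.evalEval x t := map_evalRingHom_eval x t Q
  obtain ⟨y₀, hy₀, hmin⟩ := (isCompact_Icc (a := -x) (b := x)).exists_isMinOn
    ⟨0, by constructor <;> linarith⟩
    ((P.map (evalRingHom x)).continuous.pow 2).continuousOn
  have hmin' : |P.evalEval x y₀| ≤ |P.evalEval x y| := by
    rw [← sq_le_sq]
    simpa [eval_line] using hmin (abs_le.1 hyx)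
  rcases eq_or_ne y₀ x with rfl | hne1
  · calc _ ≤ c₁ := (min_le_left _ _).trans (min_le_left _ _)
      _ ≤ |P.evalEval y₀ y| := h1x.trans hmin'
      _ ≤ _ := le_mul_of_one_le_right (abs_nonneg _) (one_le_pow₀ hw)
  rcases eq_or_ne y₀ (-x) with rfl | hne2
  · calc _ ≤ c₂ := (min_le_left _ _).trans (min_le_right _ _)
      _ ≤ |P.evalEval x y| := h2x.trans hmin'
      _ ≤ _ := le_mul_of_one_le_right (abs_nonneg _) (one_le_pow₀ hw)
  have hlt : -x < y₀ ∧ y₀ < x := ⟨lt_of_le_of_ne hy₀.1 hne2.symm, lt_of_le_of_ne hy₀.2 hne1⟩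
  have hder : (derivative P).evalEval x y₀ = 0 := by
    have h0 := (hmin.isLocalMin (Icc_mem_nhds hlt.1 hlt.2)).hasDerivAt_eq_zero
      (((P.map (evalRingHom x)).hasDerivAt y₀).pow 2)
    rw [derivative_map, eval_line, eval_line] at h0
    simpa [hP x y₀] using h0
  have hRA : R.eval x = A.evalEval x y₀ * P.evalEval x y₀ := by
    have := congrArg (evalEval x y₀) h
    rwa [evalEval_C, evalEval_add, evalEval_mul, evalEval_mul, hder, mul_zero, add_zero] at this
  have hy₀x : y₀ ^ 2 ≤ x ^ 2 := sq_le_sq' hlt.1.le hlt.2.le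
  refine (min_le_right _ _).trans ((div_le_iff₀ (by positivity)).2 ?_)
  calc c ≤ |A.evalEval x y₀| * |P.evalEval x y₀| := by rwa [← abs_mul, ← hRA]
    _ ≤ (K * (1 + x ^ 2 + y₀ ^ 2) ^ N) * |P.evalEval x y| :=
        mul_le_mul (hA x y₀) hmin' (abs_nonneg _) (by positivity)
    _ ≤ (K * (2 * (1 + x ^ 2 + y ^ 2)) ^ N) * |P.evalEval x y| := by
        gcongr
        nlinarith [sq_nonneg y]
    _ = _ := by rw [mul_pow]; ring

open Polynomial in
/-- An irreducible bivariate polynomial and its derivative generate a nonzero polynomial in the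
first variable. -/
lemma Polynomial.exists_combination_of_irreducible {P : ℝ[X][X]} (hP : Irreducible P) :
    ∃ (A B : ℝ[X][X]) (R : ℝ[X]), R ≠ 0 ∧ C R = A * P + B * derivative P := by
  by_cases hdeg : P.natDegree = 0
  · rw [natDegree_eq_zero] at hdeg
    obtain ⟨R, rfl⟩ := hdeg
    exact ⟨1, 0, R, fun h ↦ hP.ne_zero (by simp [h]), by simp⟩
  · have hirr := ((hP.isPrimitive hdeg).irreducible_iff_irreducible_map_fraction_map
      (K := FractionRing ℝ[X])).1 hP
    obtain ⟨a, b, hab⟩ := hirr.separable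
    obtain ⟨s, hs, ha⟩ := IsLocalization.integerNormalization_spec (nonZeroDivisors ℝ[X]) a
    obtain ⟨t, ht, hb⟩ := IsLocalization.integerNormalization_spec (nonZeroDivisors ℝ[X]) b
    set A := IsLocalization.integerNormalization (nonZeroDivisors ℝ[X]) a
    set B := IsLocalization.integerNormalization (nonZeroDivisors ℝ[X]) b
    refine ⟨C t * A, C s * B, s * t,
      mul_ne_zero (nonZeroDivisors.ne_zero hs) (nonZeroDivisors.ne_zero ht), ?_⟩
    apply map_injective _ (IsFractionRing.injective ℝ[X] (FractionRing ℝ[X]))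
    rw [derivative_map] at hab
    simp only [Polynomial.map_add, Polynomial.map_mul, map_C, ha, hb, map_mul, Algebra.smul_def,
      Polynomial.algebraMap_apply]
    linear_combination (-(C (algebraMap ℝ[X] (FractionRing ℝ[X]) s) *
      C (algebraMap ℝ[X] (FractionRing ℝ[X]) t))) * hab

open Polynomial in
lemma hasPolyLowerBound_sector (P : ℝ[X][X]) (hP : ∀ x y, P.evalEval x y ≠ 0) :
    ∃ r : ℝ, HasPolyLowerBound (fun p ↦ |P.evalEval p.1 p.2|) {p | r ≤ p.1 ∧ |p.2| ≤ p.1} := by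
  induction P using WfDvdMonoid.induction_on_irreducible with
  | zero => simp at hP
  | unit u hu =>
    obtain ⟨v, hv⟩ := hu.exists_left_inv
    exact hasPolyLowerBound_sector_of_combination (A := v) (B := 0) one_ne_zero (by simp [hv]) hP
  | mul a p ha hp ih =>
    simp only [evalEval_mul, mul_ne_zero_iff] at hP
    obtain ⟨A, B, R, hR, h⟩ := exists_combination_of_irreducible hp
    obtain ⟨r, hr⟩ := hasPolyLowerBound_sector_of_combination hR h fun x y ↦ (hP x y).1
    obtain ⟨s, hs⟩ := ih fun x y ↦ (hP x y).2
    refine ⟨max r s, ?_⟩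
    simp only [evalEval_mul, abs_mul]
    exact (hr.mono fun p hp ↦ ⟨(le_max_left _ _).trans hp.1, hp.2⟩).mul
      (hs.mono fun p hp ↦ ⟨(le_max_right _ _).trans hp.1, hp.2⟩)

open Polynomial in
lemma exists_bval_comp_eq (b : MvPolynomial (Fin 2) ℂ) (F G : ℝ[X][X]) :
    ∃ U V : ℝ[X][X], ∀ x y : ℝ,
      bval b (F.evalEval x y, G.evalEval x y) = U.evalEval x y + V.evalEval x y * I := by
  unfold bval
  induction b using MvPolynomial.induction_on with
  | C a => exact ⟨C (C a.re), C (C a.im), fun x y ↦ by simp [evalEval_C, re_add_im]⟩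
  | add p q hp hq =>
    obtain ⟨U, V, h⟩ := hp
    obtain ⟨U', V', h'⟩ := hq
    refine ⟨U + U', V + V', fun x y ↦ ?_⟩
    rw [map_add, h, h', evalEval_add, evalEval_add]
    push_cast
    ring
  | mul_X p i hp =>
    obtain ⟨U, V, h⟩ := hp
    refine ⟨U * ![F, G] i, V * ![F, G] i, fun x y ↦ ?_⟩
    rw [map_mul, h, evalEval_mul, evalEval_mul, MvPolynomial.eval_X]
    fin_cases i <;> simp <;> ring

open Polynomial in
lemma hasPolyLowerBound_bval_comp {b : MvPolynomial (Fin 2) ℂ} (hb : ∀ p, bval b p ≠ 0)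
    (F G : ℝ[X][X]) :
    ∃ r : ℝ, HasPolyLowerBound
      (fun p ↦ normSq (bval b (F.evalEval p.1 p.2, G.evalEval p.1 p.2)))
      {p | r ≤ p.1 ∧ |p.2| ≤ p.1} := by
  obtain ⟨U, V, h⟩ := exists_bval_comp_eq b F G
  have hUV (x y : ℝ) : (U ^ 2 + V ^ 2).evalEval x y =
      normSq (bval b (F.evalEval x y, G.evalEval x y)) := by
    rw [h, normSq_add_mul_I, evalEval_add, evalEval_pow, evalEval_pow]
  obtain ⟨r, hr⟩ := hasPolyLowerBound_sector (U ^ 2 + V ^ 2) fun x y ↦ by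
    rw [hUV]; exact normSq_eq_zero.not.2 (hb _)
  refine ⟨r, ?_⟩
  simpa only [hUV, abs_of_nonneg (normSq_nonneg _)] using hr

lemma hasTemperateGrowth_bval (b : MvPolynomial (Fin 2) ℂ) : (bval b).HasTemperateGrowth := by
  unfold bval
  induction b using MvPolynomial.induction_on with
  | C a => simp
  | add p q hp hq => simpa using hp.fun_add hq
  | mul_X p i hp =>
    simp only [map_mul, MvPolynomial.eval_X]
    refine hp.fun_mul ?_
    fin_cases i
    · exact (Complex.ofRealCLM ∘L ContinuousLinearMap.fst ℝ ℝ ℝ).hasTemperateGrowth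
    · exact (Complex.ofRealCLM ∘L ContinuousLinearMap.snd ℝ ℝ ℝ).hasTemperateGrowth

open Polynomial in
/-- A polynomial without real zeros is bounded below by a negative power of `1 + x ^ 2 + y ^ 2`. -/
lemma hasPolyLowerBound_bval {b : MvPolynomial (Fin 2) ℂ} (hb : ∀ p, bval b p ≠ 0) :
    HasPolyLowerBound (fun p ↦ normSq (bval b p)) Set.univ := by
  obtain ⟨r₁, h₁⟩ := hasPolyLowerBound_bval_comp hb (C X) X
  obtain ⟨r₂, h₂⟩ := hasPolyLowerBound_bval_comp hb (C (-X)) X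
  obtain ⟨r₃, h₃⟩ := hasPolyLowerBound_bval_comp hb X (C X)
  obtain ⟨r₄, h₄⟩ := hasPolyLowerBound_bval_comp hb X (C (-X))
  simp only [evalEval_C, evalEval_X, eval_neg, eval_X] at h₁ h₂ h₃ h₄
  set ρ := max (max r₁ r₂) (max r₃ r₄)
  have h₀ : HasPolyLowerBound (fun p ↦ normSq (bval b p)) (Set.Icc (-ρ) ρ ×ˢ Set.Icc (-ρ) ρ) :=
    .of_isCompact (isCompact_Icc.prod isCompact_Icc)
      (continuous_normSq.comp (hasTemperateGrowth_bval b).1.continuous).continuousOn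
      fun p _ ↦ normSq_pos.2 (hb p)
  have h₁' : HasPolyLowerBound (fun p ↦ normSq (bval b p)) {p | ρ ≤ p.1 ∧ |p.2| ≤ p.1} :=
    h₁.mono fun p hp ↦ ⟨(by simp [ρ] : r₁ ≤ ρ).trans hp.1, hp.2⟩
  have h₂' : HasPolyLowerBound (fun p ↦ normSq (bval b p)) {p | ρ ≤ -p.1 ∧ |p.2| ≤ -p.1} := by
    obtain ⟨N, c, hc, h⟩ := h₂
    refine ⟨N, c, hc, fun p hp ↦ ?_⟩
    simpa using h (-p.1, p.2) ⟨(by simp [ρ] : r₂ ≤ ρ).trans hp.1, hp.2⟩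
  have h₃' : HasPolyLowerBound (fun p ↦ normSq (bval b p)) {p | ρ ≤ p.2 ∧ |p.1| ≤ p.2} := by
    obtain ⟨N, c, hc, h⟩ := h₃
    refine ⟨N, c, hc, fun p hp ↦ ?_⟩
    simpa [add_right_comm] using h (p.2, p.1) ⟨(by simp [ρ] : r₃ ≤ ρ).trans hp.1, hp.2⟩
  have h₄' : HasPolyLowerBound (fun p ↦ normSq (bval b p)) {p | ρ ≤ -p.2 ∧ |p.1| ≤ -p.2} := by
    obtain ⟨N, c, hc, h⟩ := h₄
    refine ⟨N, c, hc, fun p hp ↦ ?_⟩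
    simpa [add_right_comm] using h (-p.2, p.1) ⟨(by simp [ρ] : r₄ ≤ ρ).trans hp.1, hp.2⟩
  refine (h₀.union ((h₁'.union h₂').union (h₃'.union h₄'))).mono fun p _ ↦ ?_
  simp only [Set.mem_union, Set.mem_prod, Set.mem_Icc, Set.mem_ofPred_eq, abs_le]
  grind

/-- The reciprocal of a real function of temperate growth that is bounded below by a positive
constant has temperate growth. -/
lemma Function.HasTemperateGrowth.inv_of_le {E : Type*} [NormedAddCommGroup E] [NormedSpace ℝ E]
    {f : E → ℝ} (hf : f.HasTemperateGrowth) {c : ℝ} (hc : 0 < c) (h : ∀ x, c ≤ f x) :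
    (fun x ↦ (f x)⁻¹).HasTemperateGrowth := by
  have hopen : IsOpen (Set.Ioi (c / 2)) := isOpen_Ioi
  have hne {x : ℝ} (hx : x ∈ Set.Ioi (c / 2)) : x ≠ 0 := ((half_pos hc).trans hx).ne'
  refine HasTemperateGrowth.comp' (g := fun x : ℝ ↦ x⁻¹) (t := Set.Ioi (c / 2)) ?_
    hopen.uniqueDiffOn (fun x hx ↦ (contDiffAt_inv ℝ (hne hx)).contDiffWithinAt) (fun N ↦ ?_) hf
  · rintro _ ⟨x, rfl⟩
    exact (half_lt_self hc).trans_le (h x)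
  · refine ⟨0, ∑ n ∈ Finset.range (N + 1), n.factorial * ((c / 2) ^ (n + 1))⁻¹, by positivity,
      fun n hn x hx ↦ ?_⟩
    have hx' : c / 2 < x := hx
    rw [norm_iteratedFDerivWithin_eq_norm_iteratedDerivWithin,
      iteratedDerivWithin_of_isOpen hopen hx, iteratedDeriv_eq_iterate, iter_deriv_inv, pow_zero,
      mul_one]
    calc _ = n.factorial * (x ^ (n + 1))⁻¹ := by
          rw [show (-1 - n : ℤ) = -((n + 1 : ℕ) : ℤ) by push_cast; ring, zpow_neg, zpow_natCast]
          simp [abs_of_pos ((half_pos hc).trans hx')]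
      _ ≤ n.factorial * ((c / 2) ^ (n + 1))⁻¹ := by gcongr
      _ ≤ _ := Finset.single_le_sum (f := fun n : ℕ ↦ n.factorial * ((c / 2) ^ (n + 1))⁻¹)
          (fun _ _ ↦ by positivity) (Finset.mem_range.2 (by lia))

lemma hasTemperateGrowth_inv_bval {b : MvPolynomial (Fin 2) ℂ} (hb : ∀ p, bval b p ≠ 0) :
    (fun p ↦ (bval b p)⁻¹).HasTemperateGrowth := by
  obtain ⟨N, c, hc, h⟩ := hasPolyLowerBound_bval hb
  have hw : (fun p : ℝ × ℝ ↦ (1 + p.1 ^ 2 + p.2 ^ 2) ^ N).HasTemperateGrowth := by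
    have h1 := (ContinuousLinearMap.fst ℝ ℝ ℝ).hasTemperateGrowth
    have h2 := (ContinuousLinearMap.snd ℝ ℝ ℝ).hasTemperateGrowth
    exact (((Function.HasTemperateGrowth.const 1).fun_add (h1.fun_pow 2)).fun_add
      (h2.fun_pow 2)).fun_pow N
  have hbv := hasTemperateGrowth_bval b
  have hconj : (fun p ↦ starRingEnd ℂ (bval b p)).HasTemperateGrowth :=
    Complex.conjCLE.hasTemperateGrowth.comp hbv
  have hsq : (fun p ↦ normSq (bval b p)).HasTemperateGrowth := by
    have := Complex.reCLM.hasTemperateGrowth.comp (hbv.fun_mul hconj)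
    convert! this using 2 with p
    simp [mul_conj]
  have hinv := (hsq.fun_mul hw).inv_of_le hc fun p ↦ h p trivial
  have := hconj.fun_mul (Function.Complex.hasTemperateGrowth_ofReal.comp (hw.fun_mul hinv))
  convert! this using 1
  funext p
  have hwp : (1 + p.1 ^ 2 + p.2 ^ 2) ^ N ≠ 0 :=
    (pow_pos (one_pos.trans_le (one_le_one_add_sq_add_sq p)) N).ne'
  rw [Complex.inv_def, Function.comp_apply, mul_inv, mul_left_comm, mul_inv_cancel₀ hwp, mul_one]

/-- The Dirac distribution is not represented by a Schwartz function. -/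
lemma not_forall_apply_eq_integral (p₀ : ℝ × ℝ) (g : 𝓢(ℝ × ℝ, ℂ)) :
    ¬ ∀ φ : 𝓢(ℝ × ℝ, ℂ), φ p₀ = ∫ p : ℝ × ℝ, g p * φ p := by
  intro h
  have key (η : ℝ × ℝ → ℝ) (hη : ContDiff ℝ (⊤ : ℕ∞) η) (hc : HasCompactSupport η) :
      ∫ p, η p • g p = η p₀ := by
    have := h ((hc.comp_left ofReal_zero).toSchwartzMap (ofRealCLM.contDiff.comp hη))
    change ofReal (η p₀) = ∫ p, g p * ofReal (η p) at this
    simp [this, mul_comm]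
  have hae := (isOpen_compl_singleton (x := p₀)).ae_eq_zero_of_integral_contDiff_smul_eq_zero
    (μ := volume) (g.integrable.locallyIntegrable.locallyIntegrableOn _) fun η hη hc hs ↦ by
      rw [key η hη hc, image_eq_zero_of_notMem_tsupport fun hmem ↦ hs hmem rfl, ofReal_zero]
  have hg : ∀ᵐ p, g p = 0 := by
    filter_upwards [hae, Measure.ae_ne volume p₀] with p hp hp'
    exact hp hp'
  let β : ContDiffBump p₀ := ⟨1, 2, one_pos, one_lt_two⟩
  have hβ := key β β.contDiff β.hasCompactSupport
  rw [β.one_of_mem_closedBall (by simp [β.rIn_pos.le]), integral_eq_zero_of_ae] at hβ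
  · simp at hβ
  · filter_upwards [hg] with p hp
    simp [hp]

theorem statement17 (b : MvPolynomial (Fin 2) ℂ) (B : TD2 → TD2)
    -- `B` is multiplication by `b`, characterized by duality `⟨Bu, φ⟩ = ⟨u, b·φ⟩`:
    (hB : ∀ (u : TD2) (φ ψ : 𝓢(ℝ × ℝ, ℂ)),
      (∀ p : ℝ × ℝ, ψ p = bval b p * φ p) → B u φ = u ψ) :
    RegularTD B ↔ ∀ p : ℝ × ℝ, bval b p ≠ 0 := by
  constructor
  · intro hreg p₀ hp₀
    let δ : TD2 := (BoundedContinuousFunction.evalCLM ℂ p₀).comp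
      (SchwartzMap.toBoundedContinuousFunctionCLM ℂ (ℝ × ℝ) ℂ)
    have hδ (φ : 𝓢(ℝ × ℝ, ℂ)) : δ φ = φ p₀ := rfl
    obtain ⟨g, hg⟩ := hreg δ ⟨0, fun φ ↦ by
      rw [hB δ φ (smulLeftCLM ℂ (bval b) φ) fun p ↦ by
        rw [smulLeftCLM_apply_apply (hasTemperateGrowth_bval b), smul_eq_mul], hδ,
        smulLeftCLM_apply_apply (hasTemperateGrowth_bval b), hp₀]
      simp⟩
    exact not_forall_apply_eq_integral p₀ g hg
  · rintro hb u ⟨f, hf⟩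
    have hinv := hasTemperateGrowth_inv_bval hb
    refine ⟨smulLeftCLM ℂ (fun p ↦ (bval b p)⁻¹) f, fun φ ↦ ?_⟩
    rw [← hB u (smulLeftCLM ℂ (fun p ↦ (bval b p)⁻¹) φ) φ fun p ↦ by
      rw [smulLeftCLM_apply_apply hinv, smul_eq_mul, mul_inv_cancel_left₀ (hb p)], hf]
    congr with p
    rw [smulLeftCLM_apply_apply hinv, smulLeftCLM_apply_apply hinv, smul_eq_mul, smul_eq_mul]
    ring
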